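/- Let n ≥ 1 be an integer, ρ > 0, and let x₁,…,xₙ ∈ (0,1) be pairwise distinct. Let K̂ be the n×n real symmetric matrix with entries K̂_{ij} := 𝒦(x_i,x_j), and set Ĉ := max_{1≤i≤n} Ĉ_{x_i}, where Ĉ_{x_i} := C_{x_i}/√(8π) + Σ_{j≠i} √(8/π)/(x_j − x_i)² + (√2·π^{3/2}/6)·(n−1) and C_{x_i} := 2·(1/x_i² + 1/(x_i−1)²) + 2π²/3. Then in the Loewner order on symmetric matrices, ((8πρ)^{−1/2} − Ĉ·√ρ)·I ≤ K̂ ≤ ((8πρ)^{−1/2} + Ĉ·√ρ)·I. -/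

import Mathlib

open Real

/-- The kernel ρ̃(x,y) := (4πρ)^{-1/2} · Σ_{n∈ℤ} [exp(−(2n+y−x)²/(4ρ)) − exp(−(2n+y+x)²/(4ρ))]. -/
noncomputable def rhoTilde (ρ x y : ℝ) : ℝ :=
  (Real.sqrt (4 * π * ρ))⁻¹ *
    ∑' n : ℤ, (Real.exp (-(2 * (n : ℝ) + y - x) ^ 2 / (4 * ρ)) -
      Real.exp (-(2 * (n : ℝ) + y + x) ^ 2 / (4 * ρ)))

/-- The covariance kernel 𝒦(x,y) := ∫₀¹ ρ̃(x,z)·ρ̃(z,y) dz. -/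
noncomputable def covK (ρ x y : ℝ) : ℝ := ∫ z in (0 : ℝ)..1, rhoTilde ρ x z * rhoTilde ρ z y

/-- The constant C_x := 2(1/x² + 1/(x−1)²) + 2π²/3. -/
noncomputable def Cconst (x : ℝ) : ℝ := 2 * (1 / x ^ 2 + 1 / (x - 1) ^ 2) + 2 * π ^ 2 / 3

/-- The constant Ĉ_{x_i}. -/
noncomputable def ChatConst (n : ℕ) (x : Fin n → ℝ) (i : Fin n) : ℝ :=
  Cconst (x i) / Real.sqrt (8 * π) +
    (∑ j ∈ Finset.univ.erase i, Real.sqrt (8 / π) / (x j - x i) ^ 2) +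
    (Real.sqrt 2 * π ^ ((3 : ℝ) / 2) / 6) * ((n : ℝ) - 1)

/-- The `1`-periodization `∑ₙ exp (-π (n + u)² t)` of a Gaussian. -/
noncomputable def periodicGaussian (t u : ℝ) : ℝ :=
  HurwitzZeta.evenKernel (u : UnitAddCircle) t

namespace periodicGaussian

open MeasureTheory

theorem hasSum {t : ℝ} (ht : 0 < t) (u : ℝ) :
    HasSum (fun n : ℤ => exp (-π * (n + u) ^ 2 * t)) (periodicGaussian t u) :=
  HurwitzZeta.hasSum_int_evenKernel u ht

theorem neg (t u : ℝ) : periodicGaussian t (-u) = periodicGaussian t u := by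
  simp [periodicGaussian]

theorem periodic (t : ℝ) : Function.Periodic (periodicGaussian t) 1 := by
  intro u
  simp [periodicGaussian]

theorem nonneg {t : ℝ} (ht : 0 < t) (u : ℝ) : 0 ≤ periodicGaussian t u :=
  (hasSum ht u).nonneg fun _ => (exp_pos _).le

theorem continuous {t : ℝ} (ht : 0 < t) : Continuous (periodicGaussian t) := by
  have hcont : Continuous fun u : ℝ => ((periodicGaussian t u : ℝ) : ℂ) := by
    simp only [periodicGaussian, HurwitzZeta.evenKernel_def]
    refine Continuous.mul (by fun_prop) ?_
    refine continuous_iff_continuousAt.2 fun u => ?_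
    have hθ := (differentiableAt_jacobiTheta₂_fst (u * Complex.I * t)
      (τ := Complex.I * t) (by simpa)).continuousAt
    exact ContinuousAt.comp (f := fun v : ℝ => (v : ℂ) * Complex.I * t) hθ (by fun_prop)
  exact Complex.continuous_re.comp hcont

theorem exists_bound {t : ℝ} (ht : 0 < t) : ∃ C, ∀ u, ‖periodicGaussian t u‖ ≤ C := by
  obtain ⟨C, hC⟩ :=
    ((periodic t).isBounded_of_continuous one_ne_zero (continuous ht)).exists_norm_le
  exact ⟨C, fun u => hC _ ⟨u, rfl⟩⟩

theorem integrable_gaussian_shift {t : ℝ} (ht : 0 < t) (a : ℝ) :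
    Integrable fun w : ℝ => exp (-π * (w - a) ^ 2 * t) := by
  refine ((integrable_exp_neg_mul_sq (b := π * t) (by positivity)).comp_sub_right a).congr
    (.of_forall fun w => ?_)
  dsimp only
  ring_nf

theorem integrable_gaussian_mul {t : ℝ} (ht : 0 < t) (a b : ℝ) :
    Integrable fun w : ℝ => exp (-π * (w - a) ^ 2 * t) * periodicGaussian t (w - b) := by
  obtain ⟨C, hC⟩ := exists_bound ht
  exact (integrable_gaussian_shift ht a).mul_bdd (c := C)
    ((continuous ht).comp (continuous_sub_right b)).aestronglyMeasurable (.of_forall fun w => hC _)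

theorem gaussian_mul_gaussian (t w a c : ℝ) :
    exp (-π * (w - a) ^ 2 * t) * exp (-π * (c + w) ^ 2 * t) =
      exp (-π * (c + a) ^ 2 * (t / 2)) * exp (-(2 * π * t) * (w - (a - c) / 2) ^ 2) := by
  rw [← exp_add, ← exp_add]
  ring_nf

theorem integrable_gaussian_mul_gaussian {t : ℝ} (ht : 0 < t) (a c : ℝ) :
    Integrable fun w : ℝ => exp (-π * (w - a) ^ 2 * t) * exp (-π * (c + w) ^ 2 * t) := by
  simp only [gaussian_mul_gaussian]
  exact ((integrable_exp_neg_mul_sq (by positivity)).comp_sub_right _).const_mul _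

theorem integral_gaussian_mul_gaussian (t a c : ℝ) :
    ∫ w : ℝ, exp (-π * (w - a) ^ 2 * t) * exp (-π * (c + w) ^ 2 * t) =
      exp (-π * (c + a) ^ 2 * (t / 2)) * √(π / (2 * π * t)) := by
  simp only [gaussian_mul_gaussian]
  rw [integral_const_mul,
    integral_sub_right_eq_self (fun w : ℝ => exp (-(2 * π * t) * w ^ 2)), integral_gaussian]

theorem integral_gaussian_mul {t : ℝ} (ht : 0 < t) (a b : ℝ) :
    ∫ w : ℝ, exp (-π * (w - a) ^ 2 * t) * periodicGaussian t (w - b) =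
      periodicGaussian (t / 2) (a - b) * √(π / (2 * π * t)) := by
  have hint := fun n : ℤ => integrable_gaussian_mul_gaussian ht a ((n : ℝ) - b)
  have hval : HasSum (fun n : ℤ => ∫ w : ℝ, exp (-π * (w - a) ^ 2 * t) *
      exp (-π * ((n : ℝ) - b + w) ^ 2 * t))
      (periodicGaussian (t / 2) (a - b) * √(π / (2 * π * t))) := by
    simp only [integral_gaussian_mul_gaussian]
    simpa only [sub_add_eq_add_sub, add_sub_assoc] using
      (hasSum (half_pos ht) (a - b)).mul_right √(π / (2 * π * t))
  have hsum := hasSum_integral_of_summable_integral_norm hint (by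
    refine hval.summable.congr fun n => integral_congr_ae (.of_forall fun w => ?_)
    exact (norm_of_nonneg (by positivity)).symm)
  rw [← hsum.unique hval]
  refine integral_congr_ae (.of_forall fun w => ?_)
  dsimp only
  rw [tsum_mul_left, ← (hasSum ht (w - b)).tsum_eq]
  congr 2 with n
  ring_nf

/-- The convolution of two periodized Gaussians is a periodized Gaussian of half the parameter. -/
theorem integral_mul {t : ℝ} (ht : 0 < t) (a b : ℝ) :
    ∫ w in (0 : ℝ)..1, periodicGaussian t (w - a) * periodicGaussian t (w - b) =
      periodicGaussian (t / 2) (a - b) * √(π / (2 * π * t)) := by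
  have hf := integrable_gaussian_mul ht a b
  have hval := hf.hasSum_intervalIntegral_comp_add_int
  rw [integral_gaussian_mul ht] at hval
  have hsum := hasSum_integral_of_summable_integral_norm
    (μ := volume.restrict (Set.Ioc (0 : ℝ) 1)) (fun n : ℤ => (hf.comp_add_right (n : ℝ)).restrict)
    (by
      refine hval.summable.congr fun n => ?_
      rw [intervalIntegral.integral_of_le zero_le_one]
      refine integral_congr_ae (.of_forall fun w => ?_)
      exact (norm_of_nonneg (mul_nonneg (exp_pos _).le (nonneg ht _))).symm)
  simp only [intervalIntegral.integral_of_le zero_le_one] at hval ⊢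
  rw [← hsum.unique hval]
  refine integral_congr_ae (.of_forall fun w => ?_)
  dsimp only
  have hper : ∀ n : ℤ, periodicGaussian t (w + n - b) = periodicGaussian t (w - b) := fun n => by
    rw [show w + n - b = w - b + n * 1 by ring]
    exact (periodic t).int_mul n _
  simp only [hper]
  rw [tsum_mul_right, ← (hasSum ht (w - a)).tsum_eq]
  congr 2 with n
  ring_nf

theorem exp_le_inv {t v : ℝ} (ht : 0 < t) (hv : 0 < v) {w : ℝ} (hw : v ≤ w) :
    exp (-π * w ^ 2 * t) ≤ (2 * π * t)⁻¹ * (1 / v ^ 2) := by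
  have hy : 0 < π * v ^ 2 * t := by positivity
  have hexp : 2 * (π * v ^ 2 * t) ≤ exp (π * v ^ 2 * t) := by
    nlinarith [quadratic_le_exp_of_nonneg hy.le, sq_nonneg (π * v ^ 2 * t - 1)]
  calc exp (-π * w ^ 2 * t) ≤ exp (-(π * v ^ 2 * t)) := by
        rw [exp_le_exp, neg_mul, neg_mul, neg_le_neg_iff]
        gcongr
    _ ≤ (2 * (π * v ^ 2 * t))⁻¹ := by
        rw [exp_neg]
        gcongr
    _ = (2 * π * t)⁻¹ * (1 / v ^ 2) := by
        field_simp

theorem exp_nat_add_le {t u : ℝ} (ht : 0 < t) (hu : 0 < u) (n : ℕ) :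
    exp (-π * (n + u) ^ 2 * t) ≤
      (2 * π * t)⁻¹ * ((if n = 0 then 1 / u ^ 2 else 0) + 1 / (n : ℝ) ^ 2) := by
  rcases Nat.eq_zero_or_pos n with rfl | hn
  · simpa using exp_le_inv ht hu le_rfl
  · simpa [hn.ne'] using
      exp_le_inv ht (v := n) (by positivity) (le_add_of_nonneg_right hu.le)

theorem hasSum_nat_bound (t u : ℝ) :
    HasSum (fun n : ℕ => (2 * π * t)⁻¹ * ((if n = 0 then 1 / u ^ 2 else 0) + 1 / (n : ℝ) ^ 2))
      ((2 * π * t)⁻¹ * (1 / u ^ 2 + π ^ 2 / 6)) :=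
  ((hasSum_ite_eq 0 _).add hasSum_zeta_two).mul_left _

theorem le_of_mem_Ioo {t u : ℝ} (ht : 0 < t) (hu : u ∈ Set.Ioo (0 : ℝ) 1) :
    periodicGaussian t u ≤
      (2 * π * t)⁻¹ * (1 / u ^ 2 + 1 / (1 - u) ^ 2 + π ^ 2 / 3) := by
  have hsum := (hasSum ht u).summable
  have hpos : Summable fun n : ℕ => exp (-π * (((n : ℤ) : ℝ) + u) ^ 2 * t) :=
    hsum.comp_injective Nat.cast_injective
  have hneg : Summable fun n : ℕ => exp (-π * (((-((n : ℤ) + 1) : ℤ) : ℝ) + u) ^ 2 * t) :=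
    hsum.comp_injective (i := fun n : ℕ => -((n : ℤ) + 1)) fun m n h => by simpa using h
  rw [(hasSum ht u).unique (hpos.hasSum.of_nat_of_neg_add_one hneg.hasSum)]
  have h1 := hasSum_le (fun n => by simpa using exp_nat_add_le ht hu.1 n) hpos.hasSum
    (hasSum_nat_bound t u)
  have h2 := hasSum_le (fun n => ?_) hneg.hasSum (hasSum_nat_bound t (1 - u))
  · linarith
  · have := exp_nat_add_le ht (sub_pos.2 hu.2) n
    refine le_trans (le_of_eq ?_) this
    push_cast
    ring_nf

theorem le_of_dist_le {t u r : ℝ} (ht : 0 < t) (hr : 0 < r) (h0 : r ≤ u)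
    (h1 : r ≤ 1 - u) :
    periodicGaussian t u ≤ (2 * π * t)⁻¹ * (2 / r ^ 2 + π ^ 2 / 3) := by
  refine (le_of_mem_Ioo ht ⟨by linarith, by linarith⟩).trans ?_
  have hterms : 1 / u ^ 2 + 1 / (1 - u) ^ 2 ≤ 1 / r ^ 2 + 1 / r ^ 2 := by gcongr
  have hsplit : 2 / r ^ 2 = 1 / r ^ 2 + 1 / r ^ 2 := by ring
  rw [hsplit]
  gcongr

theorem one_le_zero {t : ℝ} (ht : 0 < t) : 1 ≤ periodicGaussian t 0 := by
  simpa using le_hasSum (hasSum ht 0) 0 fun _ _ => (exp_pos _).le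

theorem zero_le {t : ℝ} (ht : 0 < t) :
    periodicGaussian t 0 ≤ 1 + (2 * π * t)⁻¹ * (π ^ 2 / 3) := by
  have hnat : HasSum (fun n : ℕ => 1 / (((-((n : ℤ) + 1) : ℤ) : ℝ)) ^ 2) (π ^ 2 / 6) := by
    have hshift := (hasSum_nat_add_iff' 1).2 hasSum_zeta_two
    simpa [← neg_add_rev] using hshift
  have hint : HasSum (fun n : ℤ => 1 / (n : ℝ) ^ 2) (π ^ 2 / 6 + π ^ 2 / 6) :=
    HasSum.of_nat_of_neg_add_one (by simpa using hasSum_zeta_two) hnat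
  have hbound := (hasSum_ite_eq (0 : ℤ) (1 : ℝ)).add (hint.mul_left (2 * π * t)⁻¹)
  refine (hasSum_le (fun n => ?_) (hasSum ht 0) hbound).trans (le_of_eq (by ring))
  rcases eq_or_ne n 0 with rfl | hn
  · simp
  · have hn' : (0 : ℝ) < |(n : ℝ)| := by positivity
    simpa [hn] using exp_le_inv ht hn' le_rfl

end periodicGaussian

theorem rhoTilde_eq_periodicGaussian {ρ : ℝ} (hρ : 0 < ρ) (x y : ℝ) :
    rhoTilde ρ x y = (√(4 * π * ρ))⁻¹ *
      (periodicGaussian (1 / (π * ρ)) (y / 2 - x / 2) -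
        periodicGaussian (1 / (π * ρ)) (y / 2 + x / 2)) := by
  have ht : 0 < 1 / (π * ρ) := by positivity
  rw [rhoTilde, ← ((periodicGaussian.hasSum ht _).sub (periodicGaussian.hasSum ht _)).tsum_eq]
  congr 3 with n
  congr 2 <;> field_simp <;> ring

theorem intervalIntegral_comp_half_eq {G : ℝ → ℝ} (hG : Continuous G)
    (hper : Function.Periodic G 1) (heven : Function.Even G) :
    ∫ z in (0 : ℝ)..1, G (z / 2) = ∫ w in (0 : ℝ)..1, G w := by
  have hrefl : ∫ w in (1 / 2 : ℝ)..1, G w = ∫ w in (0 : ℝ)..1 / 2, G w := by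
    have hcomp := intervalIntegral.integral_comp_sub_left (a := 0) (b := 1 / 2) G 1
    rw [sub_zero, show (1 : ℝ) - 1 / 2 = 1 / 2 by norm_num] at hcomp
    rw [← hcomp]
    refine intervalIntegral.integral_congr fun w _ => ?_
    rw [← heven w, ← hper (-w)]
    ring_nf
  rw [intervalIntegral.integral_comp_div _ two_ne_zero, zero_div,
    ← intervalIntegral.integral_add_adjacent_intervals (a := 0) (b := (1 / 2 : ℝ)) (c := 1)
      (hG.intervalIntegrable _ _) (hG.intervalIntegrable _ _), hrefl]
  simp [two_mul]

/-- The semigroup property of the Dirichlet heat kernel on `[0, 1]`. -/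
theorem covK_eq_periodicGaussian {ρ : ℝ} (hρ : 0 < ρ) (x y : ℝ) :
    covK ρ x y = (√(8 * π * ρ))⁻¹ *
      (periodicGaussian (1 / (2 * π * ρ)) (x / 2 - y / 2) -
        periodicGaussian (1 / (2 * π * ρ)) (x / 2 + y / 2)) := by
  have ht : 0 < 1 / (π * ρ) := by positivity
  set P := periodicGaussian (1 / (π * ρ)) with hP
  have hPc : Continuous P := periodicGaussian.continuous ht
  have hPneg : ∀ u, P (-u) = P u := periodicGaussian.neg _
  have hPper : ∀ u, P (u + 1) = P u := periodicGaussian.periodic _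
  let G : ℝ → ℝ := fun w => (P (w - x / 2) - P (w - -(x / 2))) * (P (w - y / 2) - P (w - -(y / 2)))
  have hGc : Continuous G := by fun_prop
  have hGper : Function.Periodic G 1 := fun w => by
    simp only [G, add_sub_right_comm, hPper]
  have hGeven : Function.Even G := fun w => by
    have hodd : ∀ a, P (-w - a) = P (w - -a) := fun a => by
      rw [← hPneg]
      ring_nf
    simp only [G, hodd, neg_neg]
    ring
  have hconst : √(4 * π * ρ)⁻¹ * √(4 * π * ρ)⁻¹ * (2 * √(π / (2 * π * (1 / (π * ρ))))) =
      (√(8 * π * ρ))⁻¹ := by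
    rw [mul_self_sqrt (by positivity), ← sqrt_inv]
    refine ((sqrt_eq_iff_mul_self_eq (by positivity) (by positivity)).2 ?_).symm
    rw [mul_mul_mul_comm, mul_mul_mul_comm 2, mul_self_sqrt (by positivity)]
    field_simp
    norm_num
  have hint : ∀ a b, IntervalIntegrable (fun w => P (w - a) * P (w - b)) MeasureTheory.volume 0 1 :=
    fun a b => Continuous.intervalIntegrable (by fun_prop) _ _
  have hconv : ∀ a b, ∫ w in (0 : ℝ)..1, P (w - a) * P (w - b) =
      periodicGaussian (1 / (2 * π * ρ)) (a - b) * √(π / (2 * π * (1 / (π * ρ)))) := fun a b => by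
    rw [hP, periodicGaussian.integral_mul ht]
    congr 2
    field_simp
  calc covK ρ x y
      = ∫ z in (0 : ℝ)..1, √(4 * π * ρ)⁻¹ * √(4 * π * ρ)⁻¹ * G (z / 2) := by
        refine intervalIntegral.integral_congr fun z _ => ?_
        simp only [rhoTilde_eq_periodicGaussian hρ, ← hP, G, sub_neg_eq_add, sqrt_inv]
        rw [← hPneg (y / 2 - z / 2), neg_sub, add_comm (y / 2)]
        ring
    _ = √(4 * π * ρ)⁻¹ * √(4 * π * ρ)⁻¹ * ∫ w in (0 : ℝ)..1, G w := by
        rw [intervalIntegral.integral_const_mul, intervalIntegral_comp_half_eq hGc hGper hGeven]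
    _ = √(4 * π * ρ)⁻¹ * √(4 * π * ρ)⁻¹ * (2 * √(π / (2 * π * (1 / (π * ρ)))) *
        (periodicGaussian (1 / (2 * π * ρ)) (x / 2 - y / 2) -
          periodicGaussian (1 / (2 * π * ρ)) (x / 2 + y / 2))) := by
        congr 1
        have hsplit : ∀ w, G w = P (w - x / 2) * P (w - y / 2) - P (w - x / 2) * P (w - -(y / 2)) -
            (P (w - -(x / 2)) * P (w - y / 2) - P (w - -(x / 2)) * P (w - -(y / 2))) := fun w => by
          simp only [G]
          ring
        simp only [hsplit]
        rw [intervalIntegral.integral_sub ((hint _ _).sub (hint _ _)) ((hint _ _).sub (hint _ _)),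
          intervalIntegral.integral_sub (hint _ _) (hint _ _),
          intervalIntegral.integral_sub (hint _ _) (hint _ _)]
        simp only [hconv]
        rw [← periodicGaussian.neg _ (-(x / 2) - y / 2),
          ← periodicGaussian.neg _ (-(x / 2) - -(y / 2))]
        ring_nf
    _ = _ := by rw [← mul_assoc, hconst]

theorem covK_comm {ρ : ℝ} (hρ : 0 < ρ) (x y : ℝ) : covK ρ x y = covK ρ y x := by
  rw [covK_eq_periodicGaussian hρ, covK_eq_periodicGaussian hρ, ← periodicGaussian.neg,
    neg_sub, add_comm]

theorem covK_self_sub_le {ρ : ℝ} (hρ : 0 < ρ) {x : ℝ} (hx : x ∈ Set.Ioo (0 : ℝ) 1) :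
    |covK ρ x x - (√(8 * π * ρ))⁻¹| ≤ (√(8 * π * ρ))⁻¹ * (Cconst x * ρ) := by
  have ht : 0 < 1 / (2 * π * ρ) := by positivity
  have hρ' : (2 * π * (1 / (2 * π * ρ)))⁻¹ = ρ := by field_simp
  have h1 := periodicGaussian.one_le_zero ht
  have h2 := periodicGaussian.zero_le ht
  have h3 := periodicGaussian.nonneg ht x
  have h4 := periodicGaussian.le_of_mem_Ioo ht hx
  rw [hρ'] at h2 h4
  have h5 : 0 ≤ ρ * (1 / x ^ 2 + 1 / (1 - x) ^ 2) := by positivity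
  have h6 : 0 ≤ ρ * π ^ 2 := by positivity
  have hC : Cconst x * ρ = 2 * (ρ * (1 / x ^ 2 + 1 / (1 - x) ^ 2)) + 2 / 3 * (ρ * π ^ 2) := by
    rw [Cconst, ← neg_sub 1 x, neg_sq]
    ring
  rw [covK_eq_periodicGaussian hρ, sub_self, add_halves, ← mul_sub_one, abs_mul,
    abs_of_nonneg (by positivity : 0 ≤ (√(8 * π * ρ))⁻¹), hC]
  gcongr
  rw [abs_le]
  constructor <;> linarith

theorem abs_covK_le {ρ : ℝ} (hρ : 0 < ρ) {x y : ℝ} (hx : x ∈ Set.Ioo (0 : ℝ) 1)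
    (hy : y ∈ Set.Ioo (0 : ℝ) 1) (hxy : x ≠ y) :
    |covK ρ x y| ≤ (√(8 * π * ρ))⁻¹ * ((8 / (y - x) ^ 2 + 2 * π ^ 2 / 3) * ρ) := by
  wlog hlt : y < x generalizing x y
  · rw [covK_comm hρ, ← neg_sub x y, neg_sq]
    exact this hy hx hxy.symm (lt_of_le_of_ne (not_lt.1 hlt) hxy)
  have ht : 0 < 1 / (2 * π * ρ) := by positivity
  have hρ' : (2 * π * (1 / (2 * π * ρ)))⁻¹ = ρ := by field_simp
  obtain ⟨hx0, hx1⟩ := hx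
  obtain ⟨hy0, hy1⟩ := hy
  have h1 := periodicGaussian.nonneg ht (x / 2 - y / 2)
  have h2 := periodicGaussian.nonneg ht (x / 2 + y / 2)
  have h3 := periodicGaussian.le_of_dist_le ht (u := x / 2 - y / 2) (r := (x - y) / 2)
    (by linarith) (by linarith) (by linarith)
  have h4 := periodicGaussian.le_of_dist_le ht (u := x / 2 + y / 2) (r := (x - y) / 2)
    (by linarith) (by linarith) (by linarith)
  have h5 : 0 ≤ ρ * π ^ 2 := by positivity
  have hr : 2 / ((x - y) / 2) ^ 2 = 8 / (y - x) ^ 2 := by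
    rw [← neg_sub x y, neg_sq, div_pow, div_div_eq_mul_div]
    norm_num
  rw [hρ', hr] at h3 h4
  rw [covK_eq_periodicGaussian hρ, abs_mul,
    abs_of_nonneg (by positivity : 0 ≤ (√(8 * π * ρ))⁻¹)]
  gcongr
  rw [abs_le]
  constructor <;> linarith

/-- A symmetric, weakly diagonally dominant real matrix is positive semidefinite. -/
theorem Matrix.posSemidef_of_sum_abs_le_diag {ι : Type*} [Fintype ι] [DecidableEq ι]
    {M : Matrix ι ι ℝ} (hM : M.IsSymm)
    (hdom : ∀ i, ∑ j ∈ Finset.univ.erase i, |M i j| ≤ M i i) : M.PosSemidef := by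
  refine .of_dotProduct_mulVec_nonneg
    (by rw [Matrix.IsHermitian, Matrix.conjTranspose_eq_transpose_of_trivial]; exact hM)
    fun v => ?_
  have hanti : ∑ i, ∑ j, |M i j| * (v i ^ 2 - v j ^ 2) = 0 := by
    simp only [mul_sub, Finset.sum_sub_distrib]
    rw [Finset.sum_comm, sub_eq_zero]
    simp only [hM.apply]
  have hrow : ∀ i, ∑ j, |M i j| * (v i ^ 2 - v j ^ 2) ≤ 2 * ∑ j, v i * (M i j * v j) := by
    intro i
    rw [← Finset.add_sum_erase _ _ (Finset.mem_univ i),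
      ← Finset.add_sum_erase (f := fun j => v i * (M i j * v j)) _ (Finset.mem_univ i)]
    have hdiag := mul_le_mul_of_nonneg_right (hdom i) (sq_nonneg (v i))
    rw [Finset.sum_mul] at hdiag
    have hoff : ∑ j ∈ Finset.univ.erase i, |M i j| * (v i ^ 2 - v j ^ 2) ≤
        ∑ j ∈ Finset.univ.erase i, (2 * (|M i j| * v i ^ 2) + 2 * (v i * (M i j * v j))) := by
      refine Finset.sum_le_sum fun j _ => ?_
      rcases abs_cases (M i j) with ⟨h, h0⟩ | ⟨h, h0⟩ <;> rw [h]
      · nlinarith [mul_nonneg h0 (sq_nonneg (v i + v j))]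
      · nlinarith [mul_nonneg (neg_pos.2 h0).le (sq_nonneg (v i - v j))]
    rw [Finset.sum_add_distrib, ← Finset.mul_sum, ← Finset.mul_sum] at hoff
    linarith
  have htotal := Finset.sum_le_sum fun i (_ : i ∈ Finset.univ) => hrow i
  rw [hanti, ← Finset.mul_sum] at htotal
  have hquad := nonneg_of_mul_nonneg_right htotal two_pos
  simpa [dotProduct, Matrix.mulVec, Finset.mul_sum] using hquad

theorem abs_sub_add_sum_le {n : ℕ} {ρ : ℝ} (hρ : 0 < ρ) {x : Fin n → ℝ}
    (hx : ∀ i, x i ∈ Set.Ioo (0 : ℝ) 1) (hdist : Function.Injective x) (i : Fin n) :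
    |covK ρ (x i) (x i) - (√(8 * π * ρ))⁻¹| + ∑ j ∈ Finset.univ.erase i, |covK ρ (x i) (x j)| ≤
      ChatConst n x i * √ρ := by
  have hn : 1 ≤ n := i.pos
  have hscale : (√(8 * π * ρ))⁻¹ * ρ = √ρ / √(8 * π) := by
    rw [sqrt_mul (by positivity), mul_inv, mul_assoc, inv_mul_eq_div, inv_mul_eq_div, div_sqrt]
  have h8 : 8 / √(8 * π) = √(8 / π) := by
    rw [sqrt_mul (by norm_num), sqrt_div (by norm_num), ← div_div, div_sqrt]
  have h2 : 2 * π ^ 2 / 3 / √(8 * π) = √2 * π ^ ((3 : ℝ) / 2) / 6 := by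
    have hpi : π ^ ((3 : ℝ) / 2) = π * √π := by
      rw [sqrt_eq_rpow, ← rpow_one_add' pi_pos.le (by norm_num)]
      norm_num
    have h8' : √(8 * π) = 2 * √2 * √π := by
      rw [sqrt_mul (by norm_num), show (8 : ℝ) = 2 ^ 2 * 2 by norm_num, sqrt_mul (by norm_num),
        sqrt_sq (by norm_num)]
    rw [hpi, h8']
    field_simp
    rw [sq_sqrt pi_pos.le, sq_sqrt (by norm_num)]
    ring
  have hoff : ∑ j ∈ Finset.univ.erase i, |covK ρ (x i) (x j)| ≤
      ∑ j ∈ Finset.univ.erase i,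
        (√(8 / π) / (x j - x i) ^ 2 + √2 * π ^ ((3 : ℝ) / 2) / 6) * √ρ := by
    refine Finset.sum_le_sum fun j hj => ?_
    refine (abs_covK_le hρ (hx i) (hx j)
      (hdist.ne (Finset.ne_of_mem_erase hj).symm)).trans (le_of_eq ?_)
    rw [mul_left_comm, hscale, ← h8, ← h2]
    ring
  have hdiag := covK_self_sub_le hρ (hx i)
  rw [mul_left_comm, hscale] at hdiag
  refine (add_le_add hdiag hoff).trans (le_of_eq ?_)
  rw [← Finset.sum_mul, Finset.sum_add_distrib, Finset.sum_const,
    Finset.card_erase_of_mem (Finset.mem_univ i), Finset.card_univ, Fintype.card_fin,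
    nsmul_eq_mul, Nat.cast_sub hn, ChatConst]
  push_cast
  ring

/-- Loewner-order bounds ((8πρ)^{-1/2} − Ĉ√ρ)·I ≤ K̂ ≤ ((8πρ)^{-1/2} + Ĉ√ρ)·I for the
covariance matrix K̂_{ij} = 𝒦(x_i, x_j). -/
theorem covK_matrix_loewner_bounds (n : ℕ) (hn : 1 ≤ n) (ρ : ℝ) (hρ : 0 < ρ)
    (x : Fin n → ℝ) (hx : ∀ i, x i ∈ Set.Ioo (0 : ℝ) 1)
    (hdist : Function.Injective x) :
    (Matrix.of (fun i j => covK ρ (x i) (x j)) -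
      ((Real.sqrt (8 * π * ρ))⁻¹ -
          (Finset.univ.sup' (Finset.univ_nonempty_iff.mpr (Fin.pos_iff_nonempty.mp hn))
            (ChatConst n x)) * Real.sqrt ρ) •
        (1 : Matrix (Fin n) (Fin n) ℝ)).PosSemidef ∧
    (((Real.sqrt (8 * π * ρ))⁻¹ +
          (Finset.univ.sup' (Finset.univ_nonempty_iff.mpr (Fin.pos_iff_nonempty.mp hn))
            (ChatConst n x)) * Real.sqrt ρ) •
        (1 : Matrix (Fin n) (Fin n) ℝ) -
      Matrix.of (fun i j => covK ρ (x i) (x j))).PosSemidef := by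
  set C := Finset.univ.sup' (Finset.univ_nonempty_iff.mpr (Fin.pos_iff_nonempty.mp hn))
    (ChatConst n x)
  have hsymm : ∀ i j, covK ρ (x i) (x j) = covK ρ (x j) (x i) := fun i j => covK_comm hρ _ _
  have hrow : ∀ i, |covK ρ (x i) (x i) - (√(8 * π * ρ))⁻¹| +
      ∑ j ∈ Finset.univ.erase i, |covK ρ (x i) (x j)| ≤ C * √ρ := fun i =>
    (abs_sub_add_sum_le hρ hx hdist i).trans
      (mul_le_mul_of_nonneg_right (Finset.le_sup' _ (Finset.mem_univ i)) (sqrt_nonneg ρ))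
  have hoff : ∀ i, ∀ j ∈ Finset.univ.erase i, (1 : Matrix (Fin n) (Fin n) ℝ) i j = 0 :=
    fun i j hj => Matrix.one_apply_ne (Finset.ne_of_mem_erase hj).symm
  constructor <;> refine Matrix.posSemidef_of_sum_abs_le_diag ?_ fun i => ?_
  · ext i j
    simp [hsymm i j, Matrix.one_apply, eq_comm]
  · simp only [Matrix.sub_apply, Matrix.smul_apply, Matrix.of_apply, smul_eq_mul,
      Matrix.one_apply_eq]
    rw [Finset.sum_congr rfl fun j hj => by rw [hoff i j hj, mul_zero, sub_zero]]
    linarith [hrow i, neg_abs_le (covK ρ (x i) (x i) - (√(8 * π * ρ))⁻¹)]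
  · ext i j
    simp [hsymm i j, Matrix.one_apply, eq_comm]
  · simp only [Matrix.sub_apply, Matrix.smul_apply, Matrix.of_apply, smul_eq_mul,
      Matrix.one_apply_eq]
    rw [Finset.sum_congr rfl fun j hj => by rw [hoff i j hj, mul_zero, zero_sub, abs_neg]]
    linarith [hrow i, le_abs_self (covK ρ (x i) (x i) - (√(8 * π * ρ))⁻¹)]
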